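/- arXiv:1102.1432 — 2 statements merged into one kernel-verified Lean document; each statement's English description precedes it below -/
import Mathlib

section
/- (Counting roots in an open unit disk.) Let k be an algebraically closed field that is complete with respect to a nontrivial non-Archimedean absolute value |·|. Let F ∈ k[X] be a nonzero polynomial and let a ∈ k. Write G(X) = F(X + a), let M = max over i of |G.coeff i|, and let n be the least index i with |G.coeff i| = M. Then the number of roots x of F with |x − a| < 1, counted with multiplicity (i.e., the cardinality of the multiset obtained by filtering the root multiset of F by the condition |x − a| < 1), equals n. -/
open Polynomial

theorem norm_sub_le_max_of_ultrametric {E : Type*} [SeminormedAddCommGroup E]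
    [IsUltrametricDist E] (x y : E) : ‖x - y‖ ≤ max ‖x‖ ‖y‖ := by
  simpa [sub_eq_add_neg] using IsUltrametricDist.norm_add_le_max x (-y)

theorem norm_sub_eq_max_of_ultrametric {E : Type*} [SeminormedAddCommGroup E]
    [IsUltrametricDist E] (x y : E) (h : ‖x‖ ≠ ‖y‖) : ‖x - y‖ = max ‖x‖ ‖y‖ := by
  have h_neg : ‖x‖ ≠ ‖-y‖ := by rwa [norm_neg]
  simpa [sub_eq_add_neg] using IsUltrametricDist.norm_add_eq_max_of_norm_ne_norm h_neg

/-- `n` is the least index at which the coefficients of `G` attain their maximal norm `M`. -/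
def IsLeastMaxIndex {k : Type*} [NormedField k] (G : k[X]) (M : ℝ) (n : ℕ) : Prop :=
  (∀ i, ‖G.coeff i‖ ≤ M) ∧ ‖G.coeff n‖ = M ∧ ∀ i < n, ‖G.coeff i‖ < M

namespace IsLeastMaxIndex

variable {k : Type*} [NormedField k] {G : k[X]} {M : ℝ} {n : ℕ}

theorem eq_of_least {N : ℝ} {m : ℕ} (h : IsLeastMaxIndex G M n)
    (hub : ∀ i, ‖G.coeff i‖ ≤ N) (hm : ‖G.coeff m‖ = N)
    (hleast : ∀ i, ‖G.coeff i‖ = N → m ≤ i) : n = m := by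
  obtain ⟨h1, h2, h3⟩ := h
  have hMN : M = N := le_antisymm (h2 ▸ hub n) (hm ▸ h1 m)
  refine le_antisymm ?_ (hleast n (h2.trans hMN))
  by_contra! hlt
  exact (h3 m hlt).ne (hm.trans hMN.symm)

theorem C_mul {c : k} (hc : c ≠ 0) (h : IsLeastMaxIndex G M n) :
    IsLeastMaxIndex (C c * G) (‖c‖ * M) n := by
  obtain ⟨h1, h2, h3⟩ := h
  have hc' : 0 < ‖c‖ := norm_pos_iff.mpr hc
  refine ⟨fun i => ?_, ?_, fun i hi => ?_⟩ <;> rw [coeff_C_mul, norm_mul]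
  · exact mul_le_mul_of_nonneg_left (h1 i) hc'.le
  · rw [h2]
  · exact mul_lt_mul_of_pos_left (h3 i hi) hc'

theorem one : IsLeastMaxIndex (1 : k[X]) 1 0 := by
  refine ⟨fun i => ?_, by simp, fun i hi => absurd hi (Nat.not_lt_zero i)⟩
  rw [coeff_one]
  split_ifs <;> simp

variable [IsUltrametricDist k]

/-- Multiplying by a linear factor with root in the open unit disk raises the index by one. -/
theorem X_sub_C_mul_of_norm_lt_one {r : k} (hM : 0 < M) (hr : ‖r‖ < 1)
    (h : IsLeastMaxIndex G M n) : IsLeastMaxIndex ((X - C r) * G) M (n + 1) := by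
  obtain ⟨h1, h2, h3⟩ := h
  have hrG : ∀ i, ‖r * G.coeff i‖ < M := fun i => by
    rw [norm_mul]
    calc ‖r‖ * ‖G.coeff i‖ ≤ ‖r‖ * M := mul_le_mul_of_nonneg_left (h1 i) (norm_nonneg r)
      _ < M := mul_lt_of_lt_one_left hM hr
  have h_zero : ‖((X - C r) * G).coeff 0‖ < M := by
    simpa [sub_mul] using hrG 0
  have h_succ : ∀ i, ((X - C r) * G).coeff (i + 1) = G.coeff i - r * G.coeff (i + 1) :=
    fun i => by simp [sub_mul]
  refine ⟨fun i => ?_, ?_, fun i hi => ?_⟩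
  · cases i with
    | zero => exact h_zero.le
    | succ i =>
      rw [h_succ]
      exact (norm_sub_le_max_of_ultrametric _ _).trans (max_le (h1 i) (hrG _).le)
  · rw [h_succ, norm_sub_eq_max_of_ultrametric, h2, max_eq_left (hrG _).le]
    rw [h2]
    exact (hrG _).ne'
  · cases i with
    | zero => exact h_zero
    | succ i =>
      rw [h_succ]
      exact (norm_sub_le_max_of_ultrametric _ _).trans_lt
        (max_lt (h3 i (Nat.lt_of_succ_lt_succ hi)) (hrG _))

/-- Multiplying by a linear factor with root outside the open unit disk preserves the index. -/
theorem X_sub_C_mul_of_one_le_norm {r : k} (hM : 0 < M) (hr : 1 ≤ ‖r‖)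
    (h : IsLeastMaxIndex G M n) : IsLeastMaxIndex ((X - C r) * G) (‖r‖ * M) n := by
  obtain ⟨h1, h2, h3⟩ := h
  have hr' : 0 < ‖r‖ := one_pos.trans_le hr
  have hMr : M ≤ ‖r‖ * M := le_mul_of_one_le_left hM.le hr
  have hrG : ∀ i, ‖r * G.coeff i‖ ≤ ‖r‖ * M := fun i => by
    rw [norm_mul]
    exact mul_le_mul_of_nonneg_left (h1 i) hr'.le
  have hrG_lt : ∀ i < n, ‖r * G.coeff i‖ < ‖r‖ * M := fun i hi => by
    rw [norm_mul]
    exact mul_lt_mul_of_pos_left (h3 i hi) hr'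
  have h_zero : ‖((X - C r) * G).coeff 0‖ = ‖r * G.coeff 0‖ := by simp [sub_mul]
  have h_succ : ∀ i, ((X - C r) * G).coeff (i + 1) = G.coeff i - r * G.coeff (i + 1) :=
    fun i => by simp [sub_mul]
  refine ⟨fun i => ?_, ?_, fun i hi => ?_⟩
  · cases i with
    | zero => exact h_zero.trans_le (hrG 0)
    | succ i =>
      rw [h_succ]
      exact (norm_sub_le_max_of_ultrametric _ _).trans (max_le ((h1 i).trans hMr) (hrG _))
  · have hn : ‖r * G.coeff n‖ = ‖r‖ * M := by rw [norm_mul, h2]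
    cases n with
    | zero => exact h_zero.trans hn
    | succ n =>
      have hlt : ‖G.coeff n‖ < ‖r * G.coeff (n + 1)‖ :=
        hn ▸ (h3 n n.lt_succ_self).trans_le hMr
      rw [h_succ, norm_sub_eq_max_of_ultrametric _ _ hlt.ne,
        max_eq_right hlt.le, hn]
  · cases i with
    | zero => exact h_zero.trans_lt (hrG_lt 0 hi)
    | succ i =>
      rw [h_succ]
      exact (norm_sub_le_max_of_ultrametric _ _).trans_lt
        (max_lt ((h3 i (i.lt_succ_self.trans hi)).trans_le hMr) (hrG_lt _ hi))

theorem exists_prod_X_sub_C (a : k) (s : Multiset k) :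
    ∃ M : ℝ, 0 < M ∧ IsLeastMaxIndex (s.map fun x => X - C (x - a)).prod M
      (Multiset.card (s.filter fun x => ‖x - a‖ < 1)) := by
  induction s using Multiset.induction_on with
  | empty => exact ⟨1, one_pos, by simpa using one⟩
  | cons x s ih =>
    obtain ⟨M, hM, h⟩ := ih
    rw [Multiset.map_cons, Multiset.prod_cons]
    by_cases hx : ‖x - a‖ < 1
    · rw [Multiset.filter_cons_of_pos (p := fun x => ‖x - a‖ < 1) s hx, Multiset.card_cons]
      exact ⟨M, hM, h.X_sub_C_mul_of_norm_lt_one hM hx⟩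
    · rw [Multiset.filter_cons_of_neg (p := fun x => ‖x - a‖ < 1) s hx]
      have hx' := not_lt.mp hx
      exact ⟨_, mul_pos (one_pos.trans_le hx') hM, h.X_sub_C_mul_of_one_le_norm hM hx'⟩

end IsLeastMaxIndex

theorem Polynomial.Splits.comp_X_add_C_eq_prod_roots {k : Type*} [Field k] {F : k[X]}
    (hF : F.Splits) (a : k) :
    F.comp (X + C a) = C F.leadingCoeff * (F.roots.map fun x => X - C (x - a)).prod := by
  conv_lhs => rw [hF.eq_prod_roots]
  rw [mul_comp, C_comp, multiset_prod_comp, Multiset.map_map]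
  congr 3
  funext x
  simp only [Function.comp_apply, sub_comp, X_comp, C_comp, C_sub]
  ring

/-- Counting roots in an open unit disk.  Let `k` be an algebraically closed field, complete
with respect to a nontrivial non-Archimedean absolute value.  Let `F ≠ 0` be a polynomial,
`a ∈ k`, and set `G(X) = F(X + a)`.  If `M` is the maximum of the absolute values of the
coefficients of `G` and `n` is the least index at which this maximum is attained, then the
number of roots `x` of `F` with `|x − a| < 1`, counted with multiplicity, equals `n`. -/
theorem card_roots_in_open_unit_disk {k : Type*} [NontriviallyNormedField k]
    [IsAlgClosed k] [CompleteSpace k] [IsUltrametricDist k]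
    (F : k[X]) (hF : F ≠ 0) (a : k) (M : ℝ) (n : ℕ)
    (hub : ∀ i, ‖(F.comp (X + C a)).coeff i‖ ≤ M)
    (hn : ‖(F.comp (X + C a)).coeff n‖ = M)
    (hleast : ∀ i, ‖(F.comp (X + C a)).coeff i‖ = M → n ≤ i) :
    Multiset.card (F.roots.filter (fun x => ‖x - a‖ < 1)) = n := by
  obtain ⟨N, -, h⟩ := IsLeastMaxIndex.exists_prod_X_sub_C a F.roots
  have hC := h.C_mul (leadingCoeff_ne_zero.mpr hF)
  rw [← (IsAlgClosed.splits F).comp_X_add_C_eq_prod_roots a] at hC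
  exact hC.eq_of_least hub hn hleast
end

section
/- (Existence of a maximally complete extension.) Let k be an algebraically closed field that is complete with respect to a nontrivial non-Archimedean absolute value |·|. Then there exists a field K equipped with a non-Archimedean absolute value |·|_K and an isometric ring homomorphism ι : k → K (so |ι(a)|_K = |a| for all a ∈ k) such that: (1) K is algebraically closed; (2) K is complete; (3) K is spherically closed, i.e., every decreasing sequence of closed balls {x : |x − a_i|_K ≤ r_i} in K (with D_{i+1} ⊆ D_i for all i) has nonempty intersection; (4) the value group is all of the positive reals: for every real r > 0 there exists x ∈ K with |x|_K = r; and (5) the residue field extension is trivial: for every x ∈ K with |x|_K ≤ 1 there exists a ∈ k with |x − ι(a)|_K < 1. -/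
universe u

namespace UltraPower

open Filter Topology Polynomial

section Basic

variable {k : Type u} [NormedField k]

/-- The ring of bounded sequences in a normed field. -/
def boundedSeq (k : Type u) [NormedField k] : Subring (ℕ → k) where
  carrier := {f | ∃ C, ∀ n, ‖f n‖ ≤ C}
  mul_mem' := by
    rintro f g ⟨C, hC⟩ ⟨D, hD⟩
    refine ⟨C * D, fun n => ?_⟩
    rw [Pi.mul_apply, norm_mul]
    exact mul_le_mul (hC n) (hD n) (norm_nonneg _) ((norm_nonneg _).trans (hC n))
  one_mem' := ⟨1, fun n => by simp⟩
  add_mem' := by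
    rintro f g ⟨C, hC⟩ ⟨D, hD⟩
    exact ⟨C + D, fun n => (norm_add_le _ _).trans (add_le_add (hC n) (hD n))⟩
  zero_mem' := ⟨0, fun n => by simp⟩
  neg_mem' := by
    rintro f ⟨C, hC⟩
    exact ⟨C, fun n => by simpa using hC n⟩

/-- The limit of the norms of a bounded sequence along a nonprincipal ultrafilter. -/
noncomputable def ultraNorm (f : boundedSeq k) : ℝ :=
  limUnder (hyperfilter ℕ : Filter ℕ) fun n => ‖f.1 n‖

theorem tendsto_ultraNorm (f : boundedSeq k) :
    Tendsto (fun n => ‖f.1 n‖) (hyperfilter ℕ) (𝓝 (ultraNorm f)) := by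
  obtain ⟨C, hC⟩ := f.2
  obtain ⟨x, -, hx⟩ := (isCompact_Icc (a := (0 : ℝ)) (b := C)).ultrafilter_le_nhds
    ((hyperfilter ℕ).map fun n => ‖f.1 n‖) (by
      rw [le_principal_iff]
      exact Filter.mem_map.2 (Eventually.of_forall fun n => ⟨norm_nonneg _, hC n⟩))
  exact tendsto_nhds_limUnder ⟨x, hx⟩

theorem ultraNorm_eq_of_tendsto {f : boundedSeq k} {c : ℝ}
    (h : Tendsto (fun n => ‖f.1 n‖) (hyperfilter ℕ) (𝓝 c)) : ultraNorm f = c :=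
  tendsto_nhds_unique (tendsto_ultraNorm f) h

theorem ultraNorm_le {f : boundedSeq k} {c : ℝ}
    (h : ∀ᶠ n in (hyperfilter ℕ : Filter ℕ), ‖f.1 n‖ ≤ c) : ultraNorm f ≤ c :=
  le_of_tendsto (tendsto_ultraNorm f) h

theorem ultraNorm_nonneg (f : boundedSeq k) : 0 ≤ ultraNorm f :=
  ge_of_tendsto' (tendsto_ultraNorm f) fun _ => norm_nonneg _

theorem ultraNorm_mul (f g : boundedSeq k) : ultraNorm (f * g) = ultraNorm f * ultraNorm g :=
  ultraNorm_eq_of_tendsto <| by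
    simpa using (tendsto_ultraNorm f).mul (tendsto_ultraNorm g)

theorem ultraNorm_add_le (f g : boundedSeq k) :
    ultraNorm (f + g) ≤ ultraNorm f + ultraNorm g :=
  le_of_tendsto_of_tendsto' (tendsto_ultraNorm _)
    ((tendsto_ultraNorm f).add (tendsto_ultraNorm g)) fun _ => norm_add_le _ _

theorem ultraNorm_add_le_max [IsUltrametricDist k] (f g : boundedSeq k) :
    ultraNorm (f + g) ≤ max (ultraNorm f) (ultraNorm g) :=
  le_of_tendsto_of_tendsto' (tendsto_ultraNorm _)
    ((tendsto_ultraNorm f).max (tendsto_ultraNorm g)) fun _ => IsUltrametricDist.norm_add_le_max _ _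

/-- The constant sequences. -/
def const (k : Type u) [NormedField k] : k →+* boundedSeq k :=
  (Pi.constRingHom ℕ k).codRestrict _ fun a => ⟨‖a‖, fun _ => le_rfl⟩

theorem ultraNorm_const (a : k) : ultraNorm (const k a) = ‖a‖ :=
  ultraNorm_eq_of_tendsto tendsto_const_nhds

/-- The ideal of bounded sequences whose norm tends to zero along the ultrafilter. -/
def nullIdeal (k : Type u) [NormedField k] : Ideal (boundedSeq k) where
  carrier := {f | ultraNorm f = 0}
  add_mem' {f g} hf hg := le_antisymm
    ((ultraNorm_add_le f g).trans_eq (by rw [hf, hg, add_zero])) (ultraNorm_nonneg _)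
  zero_mem' := ultraNorm_eq_of_tendsto (by simp)
  smul_mem' f g hg := by
    change ultraNorm (f * g) = 0
    rw [ultraNorm_mul, hg, mul_zero]

theorem mem_nullIdeal {f : boundedSeq k} : f ∈ nullIdeal k ↔ ultraNorm f = 0 := Iff.rfl

instance nullIdeal_isMaximal : (nullIdeal k).IsMaximal := by
  refine Ideal.isMaximal_iff.2 ⟨?_, fun J f hJ hf hfJ => ?_⟩
  · rw [mem_nullIdeal, ← map_one (const k), ultraNorm_const]
    simp
  have hpos : 0 < ultraNorm f := lt_of_le_of_ne (ultraNorm_nonneg f) (Ne.symm hf)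
  set c := ultraNorm f with hc
  classical
  let g : boundedSeq k := ⟨fun n => if c / 2 < ‖f.1 n‖ then (f.1 n)⁻¹ else 0, (c / 2)⁻¹, fun n => by
    beta_reduce
    split_ifs with h
    · rw [norm_inv]
      exact inv_anti₀ (by positivity) h.le
    · rw [norm_zero]
      positivity⟩
  have h : 1 - g * f ∈ nullIdeal k := by
    refine ultraNorm_eq_of_tendsto (tendsto_const_nhds.congr' ?_)
    filter_upwards [(tendsto_ultraNorm f).eventually (lt_mem_nhds (half_lt_self hpos))] with n hn
    have hn0 : f.1 n ≠ 0 := norm_pos_iff.1 ((half_pos hpos).trans hn)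
    have : (1 - g * f).1 n = 1 - (if c / 2 < ‖f.1 n‖ then (f.1 n)⁻¹ else 0) * f.1 n := rfl
    rw [this, if_pos hn, inv_mul_cancel₀ hn0, sub_self, norm_zero]
  have := J.add_mem (hJ h) (J.mul_mem_left g hfJ)
  simpa using this

theorem ultraNorm_congr {f g : boundedSeq k} (h : f - g ∈ nullIdeal k) :
    ultraNorm f = ultraNorm g := by
  have key : ∀ f g : boundedSeq k, f - g ∈ nullIdeal k → ultraNorm f ≤ ultraNorm g := by
    intro f g h
    have := ultraNorm_add_le (f - g) g
    rwa [sub_add_cancel, mem_nullIdeal.1 h, zero_add] at this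
  exact le_antisymm (key _ _ h) (key _ _ (by simpa using (nullIdeal k).neg_mem h))

/-- The bounded ultrapower of a normed field. -/
abbrev UltraField (k : Type u) [NormedField k] : Type u := boundedSeq k ⧸ nullIdeal k

noncomputable instance : Field (UltraField k) := Ideal.Quotient.field _

/-- The absolute value of the bounded ultrapower. -/
noncomputable def ultraAbv (k : Type u) [NormedField k] : AbsoluteValue (UltraField k) ℝ :=
  have hout (f : boundedSeq k) :
      ultraNorm (Function.surjInv (Ideal.Quotient.mk_surjective (I := nullIdeal k))
        (Ideal.Quotient.mk _ f)) = ultraNorm f :=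
    ultraNorm_congr (Ideal.Quotient.eq.1 (Function.surjInv_eq _ _))
  { toFun x := ultraNorm (Function.surjInv (Ideal.Quotient.mk_surjective (I := nullIdeal k)) x)
    map_mul' x y := by
      obtain ⟨f, rfl⟩ := Ideal.Quotient.mk_surjective x
      obtain ⟨g, rfl⟩ := Ideal.Quotient.mk_surjective y
      rw [← map_mul, hout, hout, hout, ultraNorm_mul]
    nonneg' x := ultraNorm_nonneg _
    eq_zero' x := by
      obtain ⟨f, rfl⟩ := Ideal.Quotient.mk_surjective x
      rw [hout, Ideal.Quotient.eq_zero_iff_mem, mem_nullIdeal]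
    add_le' x y := by
      obtain ⟨f, rfl⟩ := Ideal.Quotient.mk_surjective x
      obtain ⟨g, rfl⟩ := Ideal.Quotient.mk_surjective y
      rw [← map_add, hout, hout, hout]
      exact ultraNorm_add_le f g }

theorem ultraAbv_mk (f : boundedSeq k) :
    ultraAbv k (Ideal.Quotient.mk _ f) = ultraNorm f :=
  ultraNorm_congr (Ideal.Quotient.eq.1 (Function.surjInv_eq _ _))

theorem isNonarchimedean_ultraAbv [IsUltrametricDist k] : IsNonarchimedean (ultraAbv k) := by
  intro x y
  obtain ⟨f, rfl⟩ := Ideal.Quotient.mk_surjective x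
  obtain ⟨g, rfl⟩ := Ideal.Quotient.mk_surjective y
  rw [← map_add]
  simp only [ultraAbv_mk]
  exact ultraNorm_add_le_max f g

/-- The diagonal embedding into the bounded ultrapower. -/
noncomputable def diag (k : Type u) [NormedField k] : k →+* UltraField k :=
  (Ideal.Quotient.mk _).comp (const k)

theorem ultraAbv_diag (a : k) : ultraAbv k (diag k a) = ‖a‖ :=
  (ultraAbv_mk _).trans (ultraNorm_const a)

/-- Evaluation of a bounded sequence at an index. -/
def evalAt (k : Type u) [NormedField k] (n : ℕ) : boundedSeq k →+* k :=
  (Pi.evalRingHom _ n).comp (boundedSeq k).subtype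

theorem evalAt_apply (n : ℕ) (f : boundedSeq k) : evalAt k n f = f.1 n := rfl

theorem exists_eval_eq_zero [IsAlgClosed k] {q : (boundedSeq k)[X]} (hq : q.Monic)
    (hdeg : q.natDegree ≠ 0) : ∃ z : boundedSeq k, q.eval z = 0 := by
  have hroot (n : ℕ) : ∃ z : k, (q.map (evalAt k n)).IsRoot z :=
    IsAlgClosed.exists_root _ (by
      rw [hq.degree_map]
      exact fun h => hdeg (natDegree_eq_of_degree_eq_some h))
  choose z hz using hroot
  choose C hC using fun i => (q.coeff i).2
  have hbound (n : ℕ) : ‖z n‖ ≤ ∑ i ∈ Finset.range q.natDegree, C i + 1 := by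
    have h1 := (hz n).norm_lt_cauchyBound (hq.map _).ne_zero
    have h2 : ((q.map (evalAt k n)).cauchyBound : ℝ) ≤
        ∑ i ∈ Finset.range q.natDegree, C i + 1 := by
      rw [cauchyBound, (hq.map _).leadingCoeff, hq.natDegree_map]
      simp only [nnnorm_one, div_one, NNReal.coe_add, NNReal.coe_one, add_le_add_iff_right]
      have h3 : (Finset.range q.natDegree).sup (fun i => ‖(q.map (evalAt k n)).coeff i‖₊) ≤
          ∑ i ∈ Finset.range q.natDegree, ‖(q.map (evalAt k n)).coeff i‖₊ :=
        Finset.sup_le fun i hi =>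
          Finset.single_le_sum (f := fun i => ‖(q.map (evalAt k n)).coeff i‖₊)
            (fun _ _ => zero_le) hi
      refine (NNReal.coe_le_coe.2 h3).trans ?_
      push_cast
      refine Finset.sum_le_sum fun i _ => ?_
      simpa [evalAt_apply] using hC i n
    exact (NNReal.coe_lt_coe.2 h1).le.trans h2
  refine ⟨⟨z, _, hbound⟩, Subtype.ext (funext fun n => ?_)⟩
  change evalAt k n _ = 0
  rw [← eval_map_apply]
  exact hz n

instance [IsAlgClosed k] : IsAlgClosed (UltraField k) := by
  refine IsAlgClosed.of_exists_root _ fun p hp hirr => ?_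
  obtain ⟨q, rfl, hdeg, hq⟩ := lifts_and_natDegree_eq_and_monic
    (f := Ideal.Quotient.mk (nullIdeal k))
    ((lifts_iff_coeff_lifts _).2 fun n => Ideal.Quotient.mk_surjective _) hp
  obtain ⟨z, hz⟩ := exists_eval_eq_zero hq (hdeg ▸ hirr.natDegree_pos.ne')
  exact ⟨Ideal.Quotient.mk _ z, by rw [eval_map_apply, hz, map_zero]⟩

theorem exists_forall_ultraAbv_sub_le (a : ℕ → UltraField k) (r : ℕ → ℝ)
    (h : ∀ i j, i ≤ j → ultraAbv k (a j - a i) ≤ r i) :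
    ∃ x, ∀ i, ultraAbv k (x - a i) ≤ r i := by
  choose f hf using fun i => Ideal.Quotient.mk_surjective (a i)
  obtain rfl : (fun i => Ideal.Quotient.mk _ (f i)) = a := funext hf
  simp only [← map_sub, ultraAbv_mk] at h
  classical
  let A (M : ℕ) : Set ℕ :=
    {n | M ≤ n ∧ ∀ j ≤ M, ∀ i ≤ j, ‖(f j - f i).1 n‖ ≤ r i + 1 / ((M : ℝ) + 1)}
  have hA (M : ℕ) : ∀ᶠ n in (hyperfilter ℕ : Filter ℕ), n ∈ A M := by
    refine ((eventually_ge_atTop M).filter_mono Nat.hyperfilter_le_atTop).and ?_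
    refine (Set.finite_Iic M).eventually_all.2 fun j _ => (Set.finite_Iic j).eventually_all.2
      fun i hi => ?_
    refine ((tendsto_ultraNorm (f j - f i)).eventually
      (gt_mem_nhds ((h i j hi).trans_lt ?_))).mono fun n hn => hn.le
    exact lt_add_of_pos_right _ (by positivity)
  have hr : 0 ≤ r 0 := (ultraNorm_nonneg _).trans (h 0 0 le_rfl)
  have hA0 (n : ℕ) : n ∈ A 0 := by
    refine ⟨n.zero_le, fun j hj i hi => ?_⟩
    obtain rfl : j = 0 := by lia
    obtain rfl : i = 0 := by lia
    simp only [sub_self]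
    simpa using by positivity
  let m (n : ℕ) : ℕ := Nat.findGreatest (fun M => n ∈ A M) n
  have hm (n : ℕ) : n ∈ A (m n) := Nat.findGreatest_spec (P := fun M => n ∈ A M) n.zero_le (hA0 n)
  have hle (M n : ℕ) (hn : n ∈ A M) : M ≤ m n := Nat.le_findGreatest hn.1 hn
  obtain ⟨C, hC⟩ := (f 0).2
  let x : boundedSeq k := ⟨fun n => (f (m n)).1 n, r 0 + 1 + C, fun n => by
    have h1 := (hm n).2 (m n) le_rfl 0 (Nat.zero_le _)
    have h2 : 1 / ((m n : ℝ) + 1) ≤ 1 := by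
      rw [div_le_one (by positivity)]
      simp
    have h3 := norm_add_le ((f (m n) - f 0).1 n) ((f 0).1 n)
    have h4 : (f (m n) - f 0).1 n + (f 0).1 n = (f (m n)).1 n := sub_add_cancel _ _
    rw [h4] at h3
    linarith [hC n]⟩
  refine ⟨Ideal.Quotient.mk _ x, fun i => ?_⟩
  rw [← map_sub, ultraAbv_mk]
  have hlim : Tendsto (fun M : ℕ => r i + 1 / ((M : ℝ) + 1)) atTop (𝓝 (r i)) := by
    simpa using tendsto_const_nhds.add (tendsto_one_div_add_atTop_nhds_zero_nat (𝕜 := ℝ))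
  refine ge_of_tendsto hlim ((eventually_ge_atTop i).mono fun M hM => ultraNorm_le ?_)
  filter_upwards [hA M] with n hn
  refine ((hm n).2 (m n) le_rfl i (hM.trans (hle M n hn))).trans ?_
  have : (M : ℝ) ≤ m n := Nat.cast_le.2 (hle M n hn)
  gcongr

end Basic

theorem exists_ultraAbv_eq {k : Type u} [NontriviallyNormedField k] [IsAlgClosed k] {r : ℝ}
    (hr : 0 < r) : ∃ x, ultraAbv k x = r := by
  obtain ⟨c, hc⟩ := NormedField.exists_one_lt_norm k
  choose b hb using fun n : ℕ => IsAlgClosed.exists_pow_nat_eq c n.succ_pos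
  have hbpow (n : ℕ) : ‖b n‖ ^ (n + 1) = ‖c‖ := by rw [← norm_pow, hb]
  have hb1 (n : ℕ) : 1 < ‖b n‖ := by
    by_contra! h
    exact (hc.trans_eq (hbpow n).symm).not_ge (pow_le_one₀ (norm_nonneg _) h)
  choose j hj using fun n => exists_mem_Ico_zpow hr (hb1 n)
  have hblim : Tendsto (fun n => ‖b n‖) atTop (𝓝 1) := by
    have h1 (n : ℕ) : ‖b n‖ = ‖c‖ ^ (1 / ((n : ℝ) + 1)) := by
      rw [← hbpow n, ← Real.rpow_natCast, ← Real.rpow_mul (norm_nonneg _)]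
      push_cast
      rw [mul_one_div_cancel (by positivity), Real.rpow_one]
    simp_rw [h1]
    have := ((Real.continuous_const_rpow (a := ‖c‖) (by positivity)).tendsto 0).comp
      (tendsto_one_div_add_atTop_nhds_zero_nat (𝕜 := ℝ))
    simpa [Function.comp_def] using this
  have hlim : Tendsto (fun n => ‖b n ^ j n‖) atTop (𝓝 r) := by
    refine tendsto_of_tendsto_of_tendsto_of_le_of_le (g := fun n => r / ‖b n‖) (h := fun _ => r)
      ?_ tendsto_const_nhds (fun n => ?_) (fun n => ?_)
    · simpa [Pi.div_def] using (tendsto_const_nhds (x := r)).div hblim one_ne_zero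
    · have h0 : 0 < ‖b n‖ := zero_lt_one.trans (hb1 n)
      rw [norm_zpow, div_le_iff₀ h0, ← zpow_add_one₀ h0.ne']
      exact (hj n).2.le
    · rw [norm_zpow]
      exact (hj n).1
  refine ⟨Ideal.Quotient.mk _ ⟨fun n => b n ^ j n, r, fun n => ?_⟩, ?_⟩
  · rw [norm_zpow]
    exact (hj n).1
  · rw [ultraAbv_mk]
    exact ultraNorm_eq_of_tendsto (hlim.mono_left Nat.hyperfilter_le_atTop)

theorem exists_sphericallyComplete_extension (k : Type u) [NontriviallyNormedField k]
    [IsAlgClosed k] [IsUltrametricDist k] :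
    ∃ (K : Type u) (_ : Field K) (v : AbsoluteValue K ℝ) (ι : k →+* K), IsNonarchimedean v ∧
      (∀ a, v (ι a) = ‖a‖) ∧ IsAlgClosed K ∧
      (∀ (a : ℕ → K) (r : ℕ → ℝ), (∀ i j, i ≤ j → v (a j - a i) ≤ r i) →
        ∃ x, ∀ i, v (x - a i) ≤ r i) ∧
      ∀ r : ℝ, 0 < r → ∃ x, v x = r :=
  ⟨UltraField k, inferInstance, ultraAbv k, diag k, isNonarchimedean_ultraAbv, ultraAbv_diag,
    inferInstance, exists_forall_ultraAbv_sub_le, fun _ => exists_ultraAbv_eq⟩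

end UltraPower

section TrivialResidue

open IntermediateField Polynomial

variable {K : Type*} [Field K] {v : AbsoluteValue K ℝ}

theorem IsNonarchimedean.abv_eq_of_sub_lt (hv : IsNonarchimedean v) {y t : K}
    (h : v (y - t) < v t) : v y = v t := by
  simpa using hv.add_eq_right_of_lt h

/-- The units of `K` which are approximated, up to a relative error of absolute value less
than one, by an element of the subgroup `T`. -/
def approxSubgroup (hv : IsNonarchimedean v) (T : Subgroup Kˣ) : Subgroup Kˣ where
  carrier := {y | ∃ t ∈ T, v (y - t) < v t}
  mul_mem' {y z} := by
    rintro ⟨t, ht, hyt⟩ ⟨s, hs, hzs⟩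
    refine ⟨t * s, T.mul_mem ht hs, ?_⟩
    have hz : v z = v s := hv.abv_eq_of_sub_lt hzs
    have ht0 : 0 < v t := v.pos t.ne_zero
    have hs0 : 0 < v s := v.pos s.ne_zero
    have e : ((y * z : Kˣ) : K) - (t * s : Kˣ) = (y - t) * z + t * (z - s) := by
      push_cast
      ring
    rw [e]
    refine (hv _ _).trans_lt (max_lt ?_ ?_)
    · rw [Units.val_mul, map_mul, map_mul, hz]
      exact mul_lt_mul_of_pos_right hyt hs0
    · rw [Units.val_mul, map_mul, map_mul]
      exact mul_lt_mul_of_pos_left hzs ht0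
  one_mem' := ⟨1, T.one_mem, by simp⟩
  inv_mem' {y} := by
    rintro ⟨t, ht, hyt⟩
    refine ⟨t⁻¹, T.inv_mem ht, ?_⟩
    have hy : v y = v t := hv.abv_eq_of_sub_lt hyt
    have ht0 : 0 < v t := v.pos t.ne_zero
    have e : ((y⁻¹ : Kˣ) : K) - (t⁻¹ : Kˣ) = -(y - t) * (y : K)⁻¹ * (t : K)⁻¹ := by
      push_cast
      field_simp
      ring
    rw [e, Units.val_inv_eq_inv_val, map_mul, map_mul, map_neg_eq_map, map_inv₀, map_inv₀, hy]
    refine mul_lt_of_lt_one_left (by positivity) ?_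
    rw [← div_eq_mul_inv, div_lt_one ht0]
    exact hyt

theorem mem_approxSubgroup {hv : IsNonarchimedean v} {T : Subgroup Kˣ} {y : Kˣ} :
    y ∈ approxSubgroup hv T ↔ ∃ t ∈ T, v (y - t) < v t := Iff.rfl

section AdjoinSimple

variable {L : Type*} [Field L] [IsAlgClosed L] [Algebra L K] {H : Subgroup Kˣ} {x : K}

theorem Subgroup.mem_of_eq_aeval
    (hL : ∀ (c : L) (w : Kˣ), (w : K) = algebraMap L K c → w ∈ H)
    (hx : ∀ (b : L) (w : Kˣ), (w : K) = x - algebraMap L K b → w ∈ H)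
    (p : L[X]) (w : Kˣ) (hw : (w : K) = aeval x p) : w ∈ H := by
  induction hn : p.natDegree generalizing p w with
  | zero =>
    rw [eq_C_of_natDegree_eq_zero hn, aeval_C] at hw
    exact hL _ w hw
  | succ n ih =>
    obtain ⟨b, hb⟩ := IsAlgClosed.exists_root p (by
      rw [degree_eq_natDegree (by rintro rfl; simp at hn), hn]
      exact_mod_cast n.succ_ne_zero)
    obtain ⟨q, rfl⟩ := dvd_iff_isRoot.2 hb
    have hq : q ≠ 0 := by
      rintro rfl
      simp at hn
    rw [natDegree_mul (X_sub_C_ne_zero b) hq, natDegree_X_sub_C] at hn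
    simp only [map_mul, map_sub, aeval_X, aeval_C] at hw
    have h0 := hw ▸ w.ne_zero
    rw [show w = Units.mk0 _ (left_ne_zero_of_mul h0) * Units.mk0 _ (right_ne_zero_of_mul h0) from
      Units.ext hw]
    exact H.mul_mem (hx b _ rfl) (ih q _ rfl (by lia))

theorem Subgroup.mem_of_mem_adjoin_simple
    (hL : ∀ (c : L) (w : Kˣ), (w : K) = algebraMap L K c → w ∈ H)
    (hx : ∀ (b : L) (w : Kˣ), (w : K) = x - algebraMap L K b → w ∈ H)
    (w : Kˣ) (hw : (w : K) ∈ L⟮x⟯) : w ∈ H := by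
  obtain ⟨r, s, h⟩ := (mem_adjoin_simple_iff L _).1 hw
  have h0 := h ▸ w.ne_zero
  rw [show w = Units.mk0 _ (div_ne_zero_iff.1 h0).1 / Units.mk0 _ (div_ne_zero_iff.1 h0).2 from
    Units.ext (by simpa using h)]
  exact H.div_mem (mem_of_eq_aeval hL hx r _ rfl) (mem_of_eq_aeval hL hx s _ rfl)

end AdjoinSimple

variable {k : Type*} [NormedField k] [Algebra k K]

/-- The residue field of `L` is the same as that of `k`. -/
def TrivialResidue (v : AbsoluteValue K ℝ) (L : IntermediateField k K) : Prop :=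
  ∀ x ∈ L, v x ≤ 1 → ∃ a : k, v (x - algebraMap k K a) < 1

namespace TrivialResidue

variable {L : IntermediateField k K}

theorem exists_of_sub_lt (hv : IsNonarchimedean v) (hL : TrivialResidue v L) {y c : K}
    (hc : c ∈ L) (hy : v y ≤ 1) (h : v (y - c) < 1) :
    ∃ a : k, v (y - algebraMap k K a) < 1 := by
  have hc1 : v c ≤ 1 := by
    have := hv y (-(y - c))
    rw [map_neg_eq_map] at this
    simpa using this.trans (max_le hy h.le)
  obtain ⟨a, ha⟩ := hL c hc hc1
  refine ⟨a, ?_⟩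
  have := hv (y - c) (c - algebraMap k K a)
  rw [sub_add_sub_cancel] at this
  exact this.trans_lt (max_lt h ha)

theorem of_adjoin_simple_units (x : K)
    (h : ∀ w : Kˣ, (w : K) ∈ L⟮x⟯ → v w ≤ 1 → ∃ a : k, v (w - algebraMap k K a) < 1) :
    TrivialResidue v (L⟮x⟯.restrictScalars k) := by
  intro y hy hy1
  rcases eq_or_ne y 0 with rfl | hy0
  · exact ⟨0, by simp⟩
  · exact h (Units.mk0 y hy0) hy hy1

/-- Adjoining an element every translate of which is approximated by `L` does not change the
residue field. -/
theorem adjoin_simple_of_immediate (hv : IsNonarchimedean v) [IsAlgClosed L]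
    (hL : TrivialResidue v L) {x : K} (hx : ∀ b ∈ L, ∃ c ∈ L, v (x - b - c) < v c) :
    TrivialResidue v (L⟮x⟯.restrictScalars k) := by
  refine of_adjoin_simple_units x fun w hw hw1 => ?_
  let T : Subgroup Kˣ := (Units.map (algebraMap L K : L →* K)).range
  have hT (c : K) (hc : c ∈ L) (w : Kˣ) (hwc : (w : K) = c) : w ∈ T := by
    subst hwc
    exact ⟨Units.mk0 ⟨w, hc⟩ fun h => w.ne_zero (congrArg Subtype.val h), Units.ext rfl⟩
  have hmem : w ∈ approxSubgroup hv T := by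
    refine Subgroup.mem_of_mem_adjoin_simple (L := L) (fun c w hw => ?_) (fun b w hw => ?_) w hw
    · exact ⟨w, hT _ c.2 w hw, by simp⟩
    · obtain ⟨c, hc, hlt⟩ := hx b b.2
      have hc0 : c ≠ 0 := by
        rintro rfl
        rw [map_zero] at hlt
        exact hlt.not_ge (v.nonneg _)
      refine ⟨Units.mk0 c hc0, hT c hc _ rfl, ?_⟩
      rw [hw]
      exact hlt
  obtain ⟨_, ⟨t, rfl⟩, ht⟩ := hmem
  exact hL.exists_of_sub_lt hv t.1.2 hw1
    (ht.trans_le ((hv.abv_eq_of_sub_lt ht).symm.trans_le hw1))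

/-- Adjoining an element whose absolute value is not one of an element of `L` does not change
the residue field. -/
theorem adjoin_simple_of_abv_notMem (hv : IsNonarchimedean v) [IsAlgClosed L]
    (hL : TrivialResidue v L) {x : K} (hx0 : x ≠ 0) (hx : ∀ b ∈ L, v b ≠ v x) :
    TrivialResidue v (L⟮x⟯.restrictScalars k) := by
  refine of_adjoin_simple_units x fun w hw hw1 => ?_
  let T : Subgroup Kˣ := (Units.map (algebraMap L K : L →* K)).range
  have hT (c : K) (hc : c ∈ L) (w : Kˣ) (hwc : (w : K) = c) : w ∈ T := by
    subst hwc
    exact ⟨Units.mk0 ⟨w, hc⟩ fun h => w.ne_zero (congrArg Subtype.val h), Units.ext rfl⟩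
  let ux : Kˣ := Units.mk0 x hx0
  have hmem : w ∈ approxSubgroup hv (T ⊔ Subgroup.zpowers ux) := by
    refine Subgroup.mem_of_mem_adjoin_simple (L := L) (fun c w hw => ?_) (fun b w hw => ?_) w hw
    · exact ⟨w, Subgroup.mem_sup_left (hT _ c.2 w hw), by simp⟩
    · rcases (hx b b.2).lt_or_gt with hlt | hlt
      · refine ⟨ux, Subgroup.mem_sup_right (Subgroup.mem_zpowers ux), ?_⟩
        have e : (w : K) - ux = -(b : K) := by
          rw [hw]
          exact sub_sub_cancel_left x _
        rw [e, map_neg_eq_map]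
        exact hlt
      · have hb0 : -(b : K) ≠ 0 := by
          rw [neg_ne_zero]
          intro h
          rw [h, map_zero] at hlt
          exact hlt.not_ge (v.nonneg _)
        refine ⟨Units.mk0 _ hb0, Subgroup.mem_sup_left (hT _ (L.neg_mem b.2) _ rfl), ?_⟩
        have e : (w : K) - Units.mk0 _ hb0 = x := by
          rw [hw, Units.val_mk0, sub_neg_eq_add]
          exact sub_add_cancel x _
        rw [e, Units.val_mk0, map_neg_eq_map]
        exact hlt
  obtain ⟨_, ht', ht⟩ := hmem
  obtain ⟨_, ⟨t, rfl⟩, _, ⟨n, rfl⟩, rfl⟩ := Subgroup.mem_sup.1 ht'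
  have hwt := hv.abv_eq_of_sub_lt ht
  rcases hw1.lt_or_eq with hlt | heq
  · exact ⟨0, by simpa using hlt⟩
  rw [hwt] at heq
  rw [heq] at ht
  obtain rfl : n = 0 := by
    by_contra hn
    have hm : n.natAbs ≠ 0 := Int.natAbs_ne_zero.2 hn
    have h1 : v (t.1 : K) * v x ^ n = 1 := by
      simpa [ux, map_zpow₀] using heq
    obtain ⟨c, hcL, hc⟩ : ∃ c ∈ L, v c = v x ^ n.natAbs := by
      have hvx : 0 < v x := v.pos hx0
      rcases Int.natAbs_eq n with h | h
      · refine ⟨(t.1 : K)⁻¹, L.inv_mem t.1.2, ?_⟩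
        rw [map_inv₀, ← zpow_natCast, ← h]
        exact (eq_inv_of_mul_eq_one_right h1).symm
      · refine ⟨t.1, t.1.2, ?_⟩
        rw [eq_inv_of_mul_eq_one_left h1, ← zpow_neg, ← zpow_natCast]
        congr 1
        lia
    obtain ⟨d, hd⟩ := IsAlgClosed.exists_pow_nat_eq (⟨c, hcL⟩ : L) (Nat.pos_of_ne_zero hm)
    refine hx d d.2 ((pow_left_inj₀ (v.nonneg _) (v.nonneg _) hm).1 ?_)
    rw [← map_pow, ← hc]
    exact congrArg v (congrArg Subtype.val hd)
  refine hL.exists_of_sub_lt hv t.1.2 hw1 ?_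
  simpa using ht

theorem exists_abv_sub_lt_one_of_aeval_lt_one [IsAlgClosed k] {g : k[X]} (hg : g.Monic) {x : K}
    (hx : v (aeval x g) < 1) : ∃ b : k, v (x - algebraMap k K b) < 1 := by
  by_contra! h
  rw [← eval_map_algebraMap, ((IsAlgClosed.splits g).map _).eval_eq_prod_roots_of_monic (hg.map _),
    (IsAlgClosed.splits g).roots_map] at hx
  refine hx.not_ge ?_
  generalize g.roots = s
  induction s using Multiset.induction with
  | empty => simp
  | cons a s ih =>
    simp only [Multiset.map_cons, Multiset.prod_cons, map_mul]
    exact one_le_mul_of_one_le_of_one_le (h a) ih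

/-- Elements algebraic over `L` have residues in the residue field of `k`. -/
theorem exists_of_isAlgebraic (hv : IsNonarchimedean v) [IsAlgClosed k]
    (hL : TrivialResidue v L) {x : K} (hx : IsAlgebraic L x) (hx1 : v x ≤ 1) :
    ∃ a : k, v (x - algebraMap k K a) < 1 := by
  classical
  obtain ⟨p, hp0, hp⟩ := hx
  obtain ⟨i₀, hi₀, hmax⟩ := p.support.exists_max_image (fun j => v (p.coeff j : K))
    (support_nonempty.2 hp0)
  let S := p.support.filter fun j => v (p.coeff j : K) = v (p.coeff i₀ : K)
  have hS : S.Nonempty := ⟨i₀, Finset.mem_filter.2 ⟨hi₀, rfl⟩⟩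
  set i := S.max' hS with hi
  obtain ⟨hip, hii₀⟩ := Finset.mem_filter.1 (S.max'_mem hS)
  rw [← hi] at hip hii₀
  have hc0 : p.coeff i ≠ 0 := mem_support_iff.1 hip
  have hcK : (p.coeff i : K) ≠ 0 := fun h => hc0 (Subtype.ext h)
  have hpos : 0 < v (p.coeff i : K) := v.pos hcK
  let c (j : ℕ) : K := (p.coeff j : K) / p.coeff i
  have hcL (j : ℕ) : c j ∈ L := L.div_mem (p.coeff j).2 (p.coeff i).2
  have hc1 (j : ℕ) : v (c j) ≤ 1 := by
    rw [map_div₀, div_le_one hpos, hii₀]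
    by_cases hj : j ∈ p.support
    · exact hmax j hj
    · rw [notMem_support_iff.1 hj]
      simp
  have hclt (j : ℕ) (hj : i < j) : v (c j) < 1 := by
    refine lt_of_le_of_ne (hc1 j) fun h => ?_
    rw [map_div₀, div_eq_one_iff_eq hpos.ne', hii₀] at h
    refine (S.le_max' j (Finset.mem_filter.2 ⟨?_, h⟩)).not_gt hj
    rw [mem_support_iff]
    intro h0
    rw [h0, ← hii₀, ZeroMemClass.coe_zero, map_zero] at h
    exact hpos.ne h
  have hex (j : ℕ) : ∃ a : k, v (c j - algebraMap k K a) < 1 ∧ (i < j → a = 0) ∧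
      (j = i → a = 1) := by
    rcases lt_trichotomy j i with h | rfl | h
    · obtain ⟨a, ha⟩ := hL _ (hcL j) (hc1 j)
      exact ⟨a, ha, fun h' => absurd h h'.not_gt, fun h' => absurd h' h.ne⟩
    · exact ⟨1, by simp [c, div_self hcK], fun h' => absurd h' (lt_irrefl _), fun _ => rfl⟩
    · exact ⟨0, by simpa using hclt j h, fun _ => rfl, fun h' => absurd h' h.ne'⟩
  choose a ha ha0 ha1 using hex
  let N := p.natDegree + 1
  have hiN : i < N := Nat.lt_succ_of_le (le_natDegree_of_mem_supp _ hip)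
  let g : k[X] := ∑ j ∈ Finset.range N, monomial j (a j)
  have hcoeff (j : ℕ) : g.coeff j = a j := by
    simp only [g, finsetSum_coeff, coeff_monomial, Finset.sum_ite_eq', Finset.mem_range]
    split_ifs with h
    · rfl
    · exact (ha0 j (by lia)).symm
  have hg : g.Monic := monic_of_natDegree_le_of_coeff_eq_one i
    (natDegree_le_iff_coeff_eq_zero.2 fun j hj => (hcoeff j).trans (ha0 j hj))
    ((hcoeff i).trans (ha1 i rfl))
  refine exists_abv_sub_lt_one_of_aeval_lt_one hg ?_
  have hsum : ∑ j ∈ Finset.range N, c j * x ^ j = 0 := by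
    rw [aeval_eq_sum_range] at hp
    have : ∑ j ∈ Finset.range N, c j * x ^ j =
        (∑ j ∈ Finset.range N, p.coeff j • x ^ j) / (p.coeff i : K) := by
      rw [Finset.sum_div]
      refine Finset.sum_congr rfl fun j _ => ?_
      rw [Algebra.smul_def, mul_div_right_comm]
      rfl
    rw [this, hp, zero_div]
  have e : aeval x g = ∑ j ∈ Finset.range N, -((c j - algebraMap k K (a j)) * x ^ j) := by
    simp only [sub_mul, neg_sub, Finset.sum_sub_distrib, hsum, sub_zero, g, map_sum,
      aeval_monomial]
  rw [e]
  refine (hv.apply_sum_le_sup ⟨i, Finset.mem_range.2 hiN⟩).trans_lt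
    ((Finset.sup'_lt_iff _).2 fun j _ => ?_)
  rw [map_neg_eq_map, map_mul, map_pow]
  exact (mul_le_of_le_one_right (v.nonneg _) (pow_le_one₀ (v.nonneg _) hx1)).trans_lt (ha j)

theorem bot (v : AbsoluteValue K ℝ) : TrivialResidue v (⊥ : IntermediateField k K) := by
  intro x hx _
  obtain ⟨a, rfl⟩ := mem_bot.1 hx
  exact ⟨a, by simp⟩

theorem exists_maximal (k : Type*) [NormedField k] [Algebra k K] (v : AbsoluteValue K ℝ) :
    ∃ L : IntermediateField k K, Maximal (TrivialResidue v) L := by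
  have hchains (c : Set (IntermediateField k K)) (hc : c ⊆ {L | TrivialResidue v L})
      (hchain : IsChain (· ≤ ·) c) (y : IntermediateField k K) (hy : y ∈ c) :
      TrivialResidue v (sSup c) := by
    intro x hx
    have : Nonempty c := ⟨⟨y, hy⟩⟩
    rw [sSup_eq_iSup', ← SetLike.mem_coe,
      coe_iSup_of_directed hchain.directedOn.directed_val, Set.mem_iUnion] at hx
    obtain ⟨M, hM⟩ := hx
    exact hc M.2 x hM
  obtain ⟨L, -, hL⟩ := zorn_le_nonempty₀ {L : IntermediateField k K | TrivialResidue v L}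
    (fun c hc hchain y hy => ⟨sSup c, hchains c hc hchain y hy, fun z hz => le_sSup hz⟩) ⊥ (bot v)
  exact ⟨L, hL⟩

theorem isAlgClosed_of_maximal (hL : Maximal (TrivialResidue v) L) (hv : IsNonarchimedean v)
    [IsAlgClosed k] [IsAlgClosed K] : IsAlgClosed L := by
  have hle : (algebraicClosure L K).restrictScalars k ≤ L :=
    hL.2 (fun x hx => hL.1.exists_of_isAlgebraic hv (mem_algebraicClosure_iff.1 hx)) fun x hx =>
      (algebraicClosure L K).algebraMap_mem ⟨x, hx⟩
  refine IsAlgClosed.of_exists_root _ fun p _ hirr => ?_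
  obtain ⟨x, hx⟩ := IsAlgClosed.exists_aeval_eq_zero K p (degree_pos_of_irreducible hirr).ne'
  have hxL : x ∈ L := hle (mem_algebraicClosure_iff.2 ⟨p, hirr.ne_zero, hx⟩)
  refine ⟨⟨x, hxL⟩, (algebraMap L K).injective ?_⟩
  rw [map_zero, ← hx]
  exact (aeval_algebraMap_apply K (⟨x, hxL⟩ : L) p).symm

theorem mem_of_maximal (hL : Maximal (TrivialResidue v) L) {x : K}
    (hx : TrivialResidue v (L⟮x⟯.restrictScalars k)) : x ∈ L :=
  hL.2 hx (fun y hy => L⟮x⟯.algebraMap_mem ⟨y, hy⟩) (mem_adjoin_simple_self L x)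

theorem exists_abv_eq_of_maximal (hL : Maximal (TrivialResidue v) L) (hv : IsNonarchimedean v)
    [IsAlgClosed L] {x : K} (hx : x ≠ 0) : ∃ b ∈ L, v b = v x := by
  by_contra! h
  exact h x (mem_of_maximal hL (hL.1.adjoin_simple_of_abv_notMem hv hx h)) rfl

/-- A maximal `L` is spherically complete in `K`. -/
theorem exists_mem_of_maximal (hL : Maximal (TrivialResidue v) L) (hv : IsNonarchimedean v)
    [IsAlgClosed L] {a : ℕ → K} (ha : ∀ i, a i ∈ L) {r : ℕ → ℝ} {x : K} (hx : ∀ i, v (x - a i) ≤ r i) :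
    ∃ b ∈ L, ∀ i, v (b - a i) ≤ r i := by
  by_contra! h
  have himm (b : K) (hb : b ∈ L) : ∃ c ∈ L, v (x - b - c) < v c := by
    obtain ⟨i, hi⟩ := h b hb
    refine ⟨a i - b, L.sub_mem (ha i) hb, ?_⟩
    rw [sub_sub_sub_cancel_right, v.map_sub (a i)]
    exact (hx i).trans_lt hi
  obtain ⟨i, hi⟩ := h x (mem_of_maximal hL (hL.1.adjoin_simple_of_immediate hv himm))
  exact hi.not_ge (hx i)

end TrivialResidue

end TrivialResidue

/-- Spherical completeness implies completeness. -/
theorem IsNonarchimedean.exists_limit_of_spherical {K : Type*} [Field K]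
    {v : AbsoluteValue K ℝ} (hv : IsNonarchimedean v)
    (hsph : ∀ (a : ℕ → K) (r : ℕ → ℝ), (∀ i j, i ≤ j → v (a j - a i) ≤ r i) →
      ∃ x, ∀ i, v (x - a i) ≤ r i)
    (f : ℕ → K) (hf : ∀ ε : ℝ, 0 < ε → ∃ N : ℕ, ∀ p ≥ N, ∀ q ≥ N, v (f p - f q) < ε) :
    ∃ l : K, ∀ ε : ℝ, 0 < ε → ∃ N : ℕ, ∀ n ≥ N, v (f n - l) < ε := by
  choose N hN using fun i : ℕ => hf (1 / ((i : ℝ) + 1)) (by positivity)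
  have hmono (i j : ℕ) (hij : i ≤ j) : 1 / ((j : ℝ) + 1) ≤ 1 / ((i : ℝ) + 1) := by
    have : (i : ℝ) ≤ j := Nat.cast_le.2 hij
    gcongr
  obtain ⟨l, hl⟩ := hsph (fun i => f (N i)) (fun i => 1 / ((i : ℝ) + 1)) fun i j hij => by
    have h1 := hN i (max (N i) (N j)) (le_max_left _ _) (N i) le_rfl
    have h2 := hN j (N j) le_rfl (max (N i) (N j)) (le_max_right _ _)
    have h3 := hv (f (N j) - f (max (N i) (N j))) (f (max (N i) (N j)) - f (N i))
    rw [sub_add_sub_cancel] at h3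
    exact h3.trans (max_le (h2.le.trans (hmono i j hij)) h1.le)
  refine ⟨l, fun ε hε => ?_⟩
  obtain ⟨i, hi⟩ := exists_nat_one_div_lt hε
  refine ⟨N i, fun n hn => ?_⟩
  have h := hv (f n - f (N i)) (f (N i) - l)
  rw [sub_add_sub_cancel, v.map_sub (f (N i))] at h
  exact h.trans_lt (max_lt ((hN i n hn (N i) le_rfl).trans hi) ((hl i).trans_lt hi))

/-- Existence of a maximally complete extension.  Given an algebraically closed field `k`,
complete with respect to a nontrivial non-Archimedean absolute value, there is a field `K`
with a non-Archimedean absolute value `v` and an isometric ring embedding `ι : k → K` such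
that `K` is algebraically closed, complete, spherically closed, has value group all of
`ℝ_{>0}`, and induces a trivial residue field extension. -/
theorem exists_maximally_complete_extension {k : Type u} [NontriviallyNormedField k]
    [IsAlgClosed k] [CompleteSpace k] [IsUltrametricDist k] :
    ∃ (K : Type u) (_ : Field K) (v : K → ℝ) (ι : k →+* K),
      (∀ x : K, 0 ≤ v x) ∧
      (∀ x : K, v x = 0 ↔ x = 0) ∧
      (∀ x y : K, v (x * y) = v x * v y) ∧
      (∀ x y : K, v (x + y) ≤ max (v x) (v y)) ∧
      (∀ a : k, v (ι a) = ‖a‖) ∧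
      IsAlgClosed K ∧
      -- completeness: every Cauchy sequence for `v` converges
      (∀ u : ℕ → K,
        (∀ ε : ℝ, 0 < ε → ∃ N : ℕ, ∀ p ≥ N, ∀ q ≥ N, v (u p - u q) < ε) →
        ∃ l : K, ∀ ε : ℝ, 0 < ε → ∃ N : ℕ, ∀ n ≥ N, v (u n - l) < ε) ∧
      -- spherical closedness: every decreasing sequence of closed balls has a common point
      (∀ (a : ℕ → K) (r : ℕ → ℝ), (∀ i, 0 ≤ r i) →
        (∀ i, {x : K | v (x - a (i + 1)) ≤ r (i + 1)} ⊆ {x : K | v (x - a i) ≤ r i}) →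
        ∃ x : K, ∀ i, v (x - a i) ≤ r i) ∧
      -- the value group is all of the positive reals
      (∀ r : ℝ, 0 < r → ∃ x : K, v x = r) ∧
      -- trivial residue field extension
      (∀ x : K, v x ≤ 1 → ∃ a : k, v (x - ι a) < 1) := by
  obtain ⟨K, _, w, ι, hw, hι, hK, hsphK, hvalK⟩ :=
    UltraPower.exists_sphericallyComplete_extension k
  let _ : Algebra k K := ι.toAlgebra
  obtain ⟨L, hL⟩ := TrivialResidue.exists_maximal k w
  have hLalg : IsAlgClosed L := TrivialResidue.isAlgClosed_of_maximal hL hw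
  let v : AbsoluteValue L ℝ := w.comp (algebraMap L K).injective
  have hv : IsNonarchimedean v := fun x y => hw x y
  have hsph (a : ℕ → L) (r : ℕ → ℝ) (h : ∀ i j, i ≤ j → v (a j - a i) ≤ r i) :
      ∃ x, ∀ i, v (x - a i) ≤ r i := by
    obtain ⟨x, hx⟩ := hsphK (fun i => (a i : K)) r h
    obtain ⟨b, hbL, hb⟩ := TrivialResidue.exists_mem_of_maximal hL hw (fun i => (a i).2) hx
    exact ⟨⟨b, hbL⟩, hb⟩
  refine ⟨L, inferInstance, v, algebraMap k L, v.nonneg, fun x => v.eq_zero, v.map_mul, hv,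
    hι, hLalg, hv.exists_limit_of_spherical hsph, fun a r hr hball => ?_,
    fun r hr => ?_, fun x hx => hL.1 x x.2 hx⟩
  · refine hsph a r fun i j hij => ?_
    refine antitone_nat_of_succ_le (f := fun i => {x : L | v (x - a i) ≤ r i}) hball hij ?_
    simpa using hr j
  · obtain ⟨x, hx⟩ := hvalK r hr
    have hx0 : x ≠ 0 := by
      rintro rfl
      rw [map_zero] at hx
      exact hr.ne hx
    obtain ⟨b, hbL, hb⟩ := TrivialResidue.exists_abv_eq_of_maximal hL hw hx0
    exact ⟨⟨b, hbL⟩, hb.trans hx⟩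
end
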